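/- arXiv:2003.09445 — 2 statements merged into one kernel-verified Lean document; each statement's English description precedes it below -/
import Mathlib

section
/- Let G be a finite EPPO-group with a nontrivial normal q-subgroup Q for a prime q, and let H be a solvable subgroup of G with gcd(|H|, q) = 1. Then H is either a cyclic p-group or a generalized quaternion 2-group for some prime p. -/
/-- A group is an EPPO-group if every element has prime power order. -/
def IsEPPOGroup (G : Type*) [Group G] : Prop :=
  ∀ g : G, ∃ (p n : ℕ), p.Prime ∧ orderOf g = p ^ n

lemma fpf_norm_one {K V : Type*} [Group K] [CommGroup V] [MulDistribMulAction K V]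
    (fpf : ∀ g : K, g ≠ 1 → ∀ v : V, g • v = v → v = 1) (g : K) (hg : g ≠ 1) (p : ℕ)
    (hgp : g ^ p = 1) (v : V) : ∏ j ∈ Finset.range p, (g ^ j) • v = 1 := by
  apply fpf g hg
  have h : g • ∏ j ∈ Finset.range p, (g ^ j) • v = ∏ j ∈ Finset.range p, (g ^ (j+1)) • v := by
    rw [Finset.smul_prod']
    refine Finset.prod_congr rfl fun j _ => ?_
    rw [smul_smul, pow_succ']
  rw [h]
  have h1 := Finset.prod_range_succ (fun j => (g ^ j) • v) p
  have h2 := Finset.prod_range_succ' (fun j => (g ^ j) • v) p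
  rw [h1] at h2
  simp only [hgp, pow_zero] at h2
  exact (mul_right_cancel h2).symm

lemma fpf_subgroup_one {K V : Type*} [Group K] [CommGroup V] [MulDistribMulAction K V]
    (fpf : ∀ g : K, g ≠ 1 → ∀ v : V, g • v = v → v = 1) (N : Subgroup K) [Fintype N]
    (n0 : N) (hn0 : n0 ≠ 1) (v : V) : ∏ n : N, (n : K) • v = 1 := by
  apply fpf n0 (by simpa using hn0)
  rw [Finset.smul_prod']
  simp only [smul_smul]
  exact Fintype.prod_equiv (Equiv.mulLeft n0) _ _ (fun n => by simp)

lemma fpf_key {K V : Type*} [Group K] [Finite K] [CommGroup V] [MulDistribMulAction K V]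
    (fpf : ∀ g : K, g ≠ 1 → ∀ v : V, g • v = v → v = 1) (N : Subgroup K)
    (x : K) (p : ℕ) (hp : p.Prime) (hx : x ∉ N) (hnorm : ∀ n ∈ N, x * n * x⁻¹ ∈ N)
    (hpow : ∀ n ∈ N, (n * x) ^ p = 1) (n0 : K) (hn0N : n0 ∈ N) (hn0 : n0 ≠ 1) (v : V) :
    v ^ Nat.card N = 1 := by
  classical
  have : Fintype N := Fintype.ofFinite N
  have hmem : ∀ n ∈ N, ∀ j : ℕ, (n * x) ^ j * (x ^ j)⁻¹ ∈ N := by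
    intro n hn j
    induction j with
    | zero => simp
    | succ j ih =>
      have : (n * x) ^ (j+1) * (x ^ (j+1))⁻¹ = n * (x * ((n * x) ^ j * (x ^ j)⁻¹) * x⁻¹) := by
        rw [pow_succ', pow_succ']; group
      rw [this]
      exact N.mul_mem hn (hnorm _ ih)
  have hT : ∏ n : N, ∏ j ∈ Finset.range p, (((n : K) * x) ^ j) • v = 1 := by
    refine Finset.prod_eq_one fun n _ => fpf_norm_one fpf _ ?_ p (hpow n n.2) v
    intro h
    apply hx
    have : x = (n : K)⁻¹ := (inv_eq_of_mul_eq_one_right h).symm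
    rw [this]; exact N.inv_mem n.2
  rw [Finset.prod_comm] at hT
  rw [Finset.prod_eq_single 0] at hT
  · simpa [Nat.card_eq_fintype_card] using hT
  · intro j hj hj0
    have hjp : j < p := Finset.mem_range.1 hj
    let f : N → N := fun n => ⟨((n : K) * x) ^ j * (x ^ j)⁻¹, hmem n n.2 j⟩
    have hcop : Nat.Coprime p j := Nat.coprime_of_lt_prime hj0 hjp hp
    have hf : Function.Injective f := by
      intro n m hnm
      have h1 : ((n : K) * x) ^ j = ((m : K) * x) ^ j := by
        have := congrArg Subtype.val hnm
        exact mul_right_cancel this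
      have key : ∀ g : K, g ^ p = 1 → g = (g ^ j) ^ (Nat.gcdB p j) := by
        intro g hg
        have hb := Nat.gcd_eq_gcd_ab p j
        rw [hcop.gcd_eq_one] at hb
        calc g = g ^ ((1 : ℕ) : ℤ) := by simp
          _ = _ := by rw [hb, zpow_add, zpow_mul, zpow_mul, zpow_natCast, zpow_natCast, hg]; simp
      have h2 : (n : K) * x = m * x := by
        rw [key _ (hpow n n.2), key _ (hpow m m.2), h1]
      exact Subtype.ext (mul_right_cancel h2)
    have hb : Function.Bijective f := Finite.injective_iff_bijective.1 hf
    rw [← fpf_subgroup_one fpf N ⟨n0, hn0N⟩ (by simpa [Subtype.ext_iff] using hn0) (x ^ j • v)]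
    refine Fintype.prod_bijective f hb _ _ fun n => ?_
    simp [f, smul_smul]
  · intro h
    exact absurd (Finset.mem_range.2 hp.pos) h
lemma nt_aux (p n : ℕ) (hp : p.Prime) (k t : ℤ) (hn : 1 ≤ n) (hk : (p : ℤ) ^ n ∣ k ^ p - 1)
    (ht : (p : ℤ) ^ n ∣ t * (k - 1)) (hk1 : ¬ (p : ℤ) ^ n ∣ k - 1)
    (hi : ∀ i : ℤ, ¬ (p : ℤ) ^ n ∣ i * (∑ j ∈ Finset.range p, k ^ j) + t) :
    p = 2 ∧ (p : ℤ) ^ n ∣ k + 1 ∧ (p : ℤ) ^ n ∣ 2 * t := by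
  have hpp : Prime (p : ℤ) := Nat.prime_iff_prime_int.1 hp
  have hfact := Fact.mk hp
  have hkp : (p : ℤ) ∣ k - 1 := by
    have h1 : (p : ℤ) ∣ k ^ p - 1 := (dvd_pow_self _ (by omega)).trans hk
    have h2 : ((k ^ p - 1 : ℤ) : ZMod p) = 0 := (ZMod.intCast_zmod_eq_zero_iff_dvd _ _).2 h1
    apply (ZMod.intCast_zmod_eq_zero_iff_dvd _ _).1
    push_cast at h2 ⊢
    rwa [ZMod.pow_card] at h2
  have hpt : (p : ℤ) ∣ t := by
    by_contra h
    have : IsCoprime ((p : ℤ) ^ n) t := ((Prime.coprime_iff_not_dvd hpp).2 h).pow_left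
    exact hk1 (this.dvd_of_dvd_mul_left ht)
  -- if S = p * s with s coprime to p, contradiction
  have hS : ∀ s : ℤ, (∑ j ∈ Finset.range p, k ^ j) = p * s → ¬ (p : ℤ) ∣ s → False := by
    intro s hs hps
    obtain ⟨t', rfl⟩ := hpt
    obtain ⟨u, w, huw⟩ : IsCoprime ((p : ℤ) ^ n) s := ((Prime.coprime_iff_not_dvd hpp).2 hps).pow_left
    apply hi (-t' * w)
    rw [hs]
    refine ⟨p * t' * u, ?_⟩
    linear_combination (-p * t') * huw
  rcases hp.eq_two_or_odd' with rfl | hodd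
  · refine ⟨rfl, ?_⟩
    have hsum : (∑ j ∈ Finset.range 2, k ^ j) = k + 1 := by
      simp [Finset.sum_range_succ]; ring
    rw [hsum] at hi hS
    push_cast at *
    obtain ⟨c, hc⟩ := hkp
    have hce : Odd c := by
      by_contra h
      rw [Int.not_odd_iff_even] at h
      obtain ⟨d, hd⟩ := h
      exact hS (1 + c) (by linarith) (by omega)
    have hcop : IsCoprime ((2 : ℤ) ^ n) c := by
      refine IsCoprime.pow_left ((Prime.coprime_iff_not_dvd Int.prime_two).2 ?_)
      obtain ⟨d, hd⟩ := hce
      omega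
    have h2t : (2 : ℤ) ^ n ∣ 2 * t := by
      have : (2 : ℤ) ^ n ∣ (2 * t) * c := by
        rw [hc] at ht
        rwa [show 2 * t * c = t * (2 * c) by ring]
      exact hcop.dvd_of_dvd_mul_right this
    refine ⟨?_, h2t⟩
    have h2k : (2 : ℤ) ^ n ∣ 2 * (k + 1) := by
      have : (2 : ℤ) ^ n ∣ (2 * (k + 1)) * c := by
        rwa [show 2 * (k + 1) * c = k ^ 2 - 1 by linear_combination (-(k+1)) * hc]
      exact hcop.dvd_of_dvd_mul_right this
    by_contra hk2
    have h0 := hi 0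
    have h1 := hi 1
    obtain ⟨m, rfl⟩ : ∃ m, n = m + 1 := ⟨n - 1, by omega⟩
    rw [pow_succ'] at *
    rw [mul_dvd_mul_iff_left (by norm_num)] at h2t h2k
    obtain ⟨b, hb⟩ := h2t
    obtain ⟨d, hd⟩ := h2k
    rw [zero_mul, zero_add] at h0
    have hbo : Odd b := by
      by_contra h
      rw [Int.not_odd_iff_even] at h
      obtain ⟨e, he⟩ := h
      exact h0 ⟨e, by rw [hb, he]; ring⟩
    have hdo : Odd d := by
      by_contra h
      rw [Int.not_odd_iff_even] at h
      obtain ⟨e, he⟩ := h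
      exact hk2 ⟨e, by rw [hd, he]; ring⟩
    obtain ⟨e, he⟩ := hbo
    obtain ⟨f, hf⟩ := hdo
    exact h1 ⟨e + f + 1, by rw [hd, hb, he, hf]; ring⟩
  · exfalso
    obtain ⟨c, hc⟩ := hkp
    have h := odd_sq_dvd_geom_sum₂_sub (R := ℤ) (p := p) 1 c hodd
    simp only [one_pow, mul_one] at h
    have hk' : k = 1 + p * c := by linarith
    rw [← hk'] at h
    obtain ⟨d, hd⟩ := h
    refine hS (1 + p * d) (by linear_combination hd) ?_
    intro h
    have : (p : ℤ) ∣ 1 := (dvd_add_left (dvd_mul_right _ _)).1 h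
    exact hpp.not_dvd_one this

lemma conj_zpow_prod {P : Type*} [Group P] (a y : P) (k : ℤ) (h : y * a * y⁻¹ = a ^ k) (i : ℤ) (m : ℕ) :
    (a ^ i * y) ^ m = a ^ (i * ∑ j ∈ Finset.range m, k ^ j) * y ^ m := by
  induction m with
  | zero => simp
  | succ m ih =>
    have hy : ∀ l : ℤ, y * a ^ l = a ^ (k * l) * y := by
      intro l
      rw [zpow_mul, ← h, conj_zpow]; group
    rw [pow_succ', ih]
    have : i * ∑ j ∈ Finset.range (m+1), k ^ j = i + k * (i * ∑ j ∈ Finset.range m, k ^ j) := by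
      rw [geom_sum_succ]; ring
    rw [this, zpow_add, pow_succ', mul_assoc, ← mul_assoc y, hy]
    group

lemma step_aux {P : Type*} [Group P] (p n : ℕ) (hp : p.Prime) (a y : P) (ha : orderOf a = p ^ n)
    (hu : ∀ b : P, b ^ p = 1 → b ∈ Subgroup.zpowers a) (hy : y ∉ Subgroup.zpowers a)
    (hyp : y ^ p ∈ Subgroup.zpowers a) (hnorm : y * a * y⁻¹ ∈ Subgroup.zpowers a)
    (hnc : y * a * y⁻¹ ≠ a) :
    p = 2 ∧ y * a * y⁻¹ = a⁻¹ ∧ ∃ t : ℤ, y ^ 2 = a ^ t ∧ (2 : ℤ) ^ n ∣ 2 * t ∧ ¬ (2 : ℤ) ^ n ∣ t := by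
  obtain ⟨k, hk⟩ := hnorm
  obtain ⟨t, ht⟩ := hyp
  simp only at hk ht
  have hord : ∀ z : ℤ, a ^ z = 1 ↔ (p : ℤ) ^ n ∣ z := by
    intro z
    rw [← orderOf_dvd_iff_zpow_eq_one, ha]; push_cast; rfl
  have hconjpow : ∀ m : ℕ, y ^ m * a * (y ^ m)⁻¹ = a ^ (k ^ m) := by
    intro m
    induction m with
    | zero => simp
    | succ m ih =>
      have : y ^ (m+1) * a * (y ^ (m+1))⁻¹ = y * (y ^ m * a * (y ^ m)⁻¹) * y⁻¹ := by
        rw [pow_succ']; group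
      rw [this, ih, ← conj_zpow, ← hk, ← zpow_mul, pow_succ']
  have key := nt_aux p n hp k t ?_ ?_ ?_ ?_ ?_
  · obtain ⟨rfl, h1, h2⟩ := key
    refine ⟨rfl, ?_, t, ht.symm, by simpa using h2, ?_⟩
    · rw [← hk, eq_inv_iff_mul_eq_one, ← zpow_add_one, hord]; exact h1
    · intro h
      apply hy
      apply hu
      rw [← ht, hord]; simpa using h
  · by_contra hn
    have : n = 0 := by omega
    subst this
    simp at ha
    subst ha
    simp at hnc
  · have h := hconjpow p
    rw [← ht] at h
    rw [← hord, zpow_sub, ← h]; group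
  · have h : y * a ^ t * y⁻¹ = a ^ t := by
      rw [ht]; group
    rw [← conj_zpow, ← hk, ← zpow_mul] at h
    rw [← hord, mul_sub, zpow_sub, mul_comm t k, h]; simp
  · rw [← hord, zpow_sub, hk]
    intro h
    apply hnc
    simpa [mul_inv_eq_one] using h
  · intro i h
    rw [← hord, zpow_add, ht, ← conj_zpow_prod a y k hk.symm] at h
    have h2 := hu _ h
    exact hy ((Subgroup.mul_mem_cancel_left _ (Subgroup.zpow_mem_zpowers a i)).1 h2)

lemma quat_aux {P : Type*} [Group P] (k : ℕ) (a y : P) (ha : orderOf a = 2 ^ (k + 1))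
    (hy : y ∉ Subgroup.zpowers a) (hya : y * a * y⁻¹ = a⁻¹) (hy2 : y ^ 2 = a ^ (2 ^ k))
    (hall : ∀ x, x ∈ Subgroup.zpowers a ∨ y⁻¹ * x ∈ Subgroup.zpowers a) :
    Nonempty (P ≃* QuaternionGroup (2 ^ k)) := by
  have hN : orderOf a = 2 * 2 ^ k := by rw [ha, pow_succ']
  let g : ZMod (2 * 2 ^ k) → P := fun i => a ^ (i.cast : ℤ)
  have hg : ∀ z : ℤ, g z = a ^ z := by
    intro z
    change a ^ (((z : ZMod (2 * 2 ^ k))).cast : ℤ) = a ^ z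
    rw [ZMod.coe_intCast, ← hN, zpow_mod_orderOf]
  have hswap : ∀ z : ℤ, a ^ z * y = y * a ^ (-z) := by
    intro z
    have h : y * a ^ z * y⁻¹ = a ^ (-z) := by
      rw [← conj_zpow, hya, inv_zpow, zpow_neg]
    have h2 : y * a ^ (-z) * y⁻¹ = a ^ z := by
      rw [← conj_zpow, hya, inv_zpow, zpow_neg, inv_inv]
    rw [← h2]; group
  have hginj : ∀ i j, g i = g j → i = j := by
    intro i j h
    obtain ⟨i, rfl⟩ := ZMod.intCast_surjective i
    obtain ⟨j, rfl⟩ := ZMod.intCast_surjective j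
    rw [hg, hg, zpow_eq_zpow_iff_modEq, hN] at h
    exact (ZMod.intCast_eq_intCast_iff _ _ _).2 h
  have hgmem : ∀ i, g i ∈ Subgroup.zpowers a := fun i => Subgroup.zpow_mem_zpowers _ _
  let F : QuaternionGroup (2 ^ k) → P := fun q => match q with
    | .a i => g i
    | .xa i => y * g i
  have hmul : ∀ u v, F (u * v) = F u * F v := by
    rintro (i | i) (j | j) <;> obtain ⟨i, rfl⟩ := ZMod.intCast_surjective i <;>
      obtain ⟨j, rfl⟩ := ZMod.intCast_surjective j
    · rw [QuaternionGroup.a_mul_a, ← Int.cast_add]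
      change g _ = g _ * g _
      rw [hg, hg, hg, zpow_add]
    · rw [QuaternionGroup.a_mul_xa, ← Int.cast_sub]
      change y * g _ = g _ * (y * g _)
      rw [hg, hg, hg, ← mul_assoc, hswap, mul_assoc, ← zpow_add]
      congr 2; ring
    · rw [QuaternionGroup.xa_mul_a, ← Int.cast_add]
      change y * g _ = y * g _ * g _
      rw [hg, hg, hg, mul_assoc, zpow_add]
    · rw [QuaternionGroup.xa_mul_xa]
      have : (((2 ^ k : ℕ) : ZMod (2 * 2 ^ k)) + (j : ZMod (2 * 2 ^ k)) - (i : ZMod (2 * 2 ^ k)))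
          = (((2 ^ k : ℕ) : ℤ) + j - i : ℤ) := by push_cast; rfl
      rw [this]
      change g _ = y * g _ * (y * g _)
      rw [hg, hg, hg]
      have h3 : y * a ^ i * (y * a ^ j) = y ^ 2 * (a ^ (-i) * a ^ j) := by
        rw [mul_assoc, ← mul_assoc (a ^ i), hswap, sq]; group
      rw [h3, hy2, ← zpow_natCast, ← zpow_add, ← zpow_add]
      congr 1; ring
  have hbij : Function.Bijective F := by
    constructor
    · rintro (i | i) (j | j) h
      · exact congrArg _ (hginj i j h)
      · change g i = y * g j at h
        exact absurd ((Subgroup.mul_mem_cancel_right _ (hgmem j)).1 (h ▸ hgmem i)) hy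
      · change y * g i = g j at h
        exact absurd ((Subgroup.mul_mem_cancel_right _ (hgmem i)).1 (h ▸ hgmem j)) hy
      · exact congrArg _ (hginj i j (mul_left_cancel h))
    · intro x
      rcases hall x with ⟨z, hz⟩ | ⟨z, hz⟩
      · exact ⟨.a z, (hg z).trans hz⟩
      · refine ⟨.xa z, ?_⟩
        change y * g z = x
        rw [hg]
        simp only at hz
        rw [hz]; group
  exact ⟨(MulEquiv.ofBijective (MonoidHom.mk' F hmul) hbij).symm⟩

lemma normal_center_aux {P : Type*} [Group P] [Finite P] (p : ℕ) (hp : p.Prime) (hP : IsPGroup p P)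
    (N : Subgroup P) [N.Normal] (hN : N ≠ ⊥) : ∃ c ∈ N, c ≠ 1 ∧ ∀ x, x * c * x⁻¹ = c := by
  have := Fact.mk hp
  let act : MulAction P N := MulAction.compHom N (MulAut.conjNormal (H := N))
  have hsm : ∀ (x : P) (c : N), ((x • c : N) : P) = x * c * x⁻¹ := fun x c =>
    MulAut.conjNormal_apply x c
  have hdvd : p ∣ Nat.card N := by
    obtain ⟨m, hm⟩ := IsPGroup.iff_card.1 (hP.to_subgroup N)
    rw [hm]
    refine dvd_pow_self _ ?_
    rintro rfl
    rw [pow_zero] at hm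
    exact hN (Subgroup.card_eq_one.1 hm)
  have h1 : (1 : N) ∈ MulAction.fixedPoints P N := by
    intro x
    apply Subtype.ext
    rw [hsm]; simp
  obtain ⟨c, hc, hc1⟩ := hP.exists_fixed_point_of_prime_dvd_card_of_fixed_point N hdvd h1
  refine ⟨c, c.2, ?_, fun x => ?_⟩
  · intro h
    exact hc1 (Subtype.ext h.symm)
  · rw [← hsm, hc x]

lemma pow_aux {P : Type*} [Group P] (p : ℕ) (hP : IsPGroup p P) (A : Subgroup P) (x : P)
    (hx : x ∉ A) : ∃ m : ℕ, x ^ p ^ m ∉ A ∧ (x ^ p ^ m) ^ p ∈ A := by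
  classical
  have hex : ∃ m, x ^ p ^ m ∈ A := by
    obtain ⟨m, hm⟩ := hP x
    exact ⟨m, hm ▸ A.one_mem⟩
  have h0 : Nat.find hex ≠ 0 := by
    intro h
    have := Nat.find_spec hex
    rw [h] at this
    simp at this
    exact hx this
  refine ⟨Nat.find hex - 1, Nat.find_min hex (by omega), ?_⟩
  rw [← pow_mul, ← pow_succ, Nat.sub_add_cancel (by omega)]
  exact Nat.find_spec hex

theorem classify_aux {P : Type*} [Group P] [Finite P] (p : ℕ) (hp : p.Prime) (hP : IsPGroup p P)
    (hu0 : ∀ a b : P, a * b = b * a → orderOf a = p → b ^ p = 1 → b ∈ Subgroup.zpowers a) :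
    IsCyclic P ∨ ∃ k : ℕ, 1 ≤ k ∧ Nonempty (P ≃* QuaternionGroup (2 ^ k)) := by
  classical
  have := Fact.mk hp
  rcases subsingleton_or_nontrivial P with hs | hnt
  · left; infer_instance
  have hordp : ∀ x : P, x ∉ (⊥ : Subgroup P) → ∃ m : ℕ, orderOf (x ^ p ^ m) = p := by
    intro x hx
    obtain ⟨m, hm1, hm2⟩ := pow_aux p hP ⊥ x hx
    rw [Subgroup.mem_bot] at hm1 hm2
    exact ⟨m, orderOf_eq_prime hm2 hm1⟩
  obtain ⟨z, hzc, hz⟩ : ∃ z : P, (∀ x, x * z = z * x) ∧ orderOf z = p := by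
    obtain ⟨c, -, hc1, hc⟩ := normal_center_aux p hp hP (⊤ : Subgroup P) top_ne_bot
    obtain ⟨m, hm⟩ := hordp c (by simpa using hc1)
    refine ⟨_, fun x => ?_, hm⟩
    have : Commute x c := mul_inv_eq_iff_eq_mul.1 (hc x)
    exact this.pow_right _
  have hu : ∀ a : P, a ≠ 1 → ∀ b : P, b ^ p = 1 → b ∈ Subgroup.zpowers a := by
    intro a ha b hb
    obtain ⟨m, hm⟩ := hordp a (by simpa using ha)
    have h1 : b ∈ Subgroup.zpowers z := hu0 z b (hzc b).symm hz hb
    have h2 : z ∈ Subgroup.zpowers (a ^ p ^ m) := hu0 _ z (hzc _) hm (hz ▸ pow_orderOf_eq_one z)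
    have h3 : Subgroup.zpowers z ≤ Subgroup.zpowers (a ^ p ^ m) := by simpa using h2
    have h4 : Subgroup.zpowers (a ^ p ^ m) ≤ Subgroup.zpowers a := by
      rw [Subgroup.zpowers_le]
      exact Subgroup.npow_mem_zpowers a _
    exact h4 (h3 h1)
  have hznorm : (Subgroup.zpowers z).Normal := by
    refine ⟨fun n hn g => ?_⟩
    obtain ⟨i, rfl⟩ := hn
    have : g * z ^ i * g⁻¹ = z ^ i := by
      rw [mul_inv_eq_iff_eq_mul]
      exact (show Commute g z from hzc g).zpow_right i
    simp only [this]
    exact Subgroup.zpow_mem_zpowers _ _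
  have : Nonempty {a : P // (Subgroup.zpowers a).Normal} := ⟨⟨z, hznorm⟩⟩
  obtain ⟨⟨a, hanorm⟩, hmax⟩ :=
    Finite.exists_max (fun a : {a : P // (Subgroup.zpowers a).Normal} => orderOf a.1)
  have hmax' : ∀ b : P, (Subgroup.zpowers b).Normal → orderOf b ≤ orderOf a := fun b hb => hmax ⟨b, hb⟩
  have ha1 : a ≠ 1 := by
    rintro rfl
    have := hmax' z hznorm
    rw [hz, orderOf_one] at this
    exact absurd hp.one_lt (by omega)
  obtain ⟨n, hn⟩ := IsPGroup.iff_orderOf.1 hP a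
  have hconjA : ∀ x, x * a * x⁻¹ ∈ Subgroup.zpowers a := fun x =>
    hanorm.conj_mem a (Subgroup.mem_zpowers a) x
  -- self-centralizing
  have hcent : ∀ h : P, h * a = a * h → h ∈ Subgroup.zpowers a := by
    by_contra! hcon
    obtain ⟨h0, hh0, hh0A⟩ := hcon
    let A := Subgroup.zpowers a
    let C := Subgroup.centralizer (A : Set P)
    have hC : ∀ h, h ∈ C ↔ h * a = a * h := by
      intro h
      constructor
      · intro hh
        exact (Subgroup.mem_centralizer_iff.1 hh a (Subgroup.mem_zpowers a)).symm
      · intro hh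
        rw [Subgroup.mem_centralizer_iff]
        rintro _ ⟨i, rfl⟩
        exact ((show Commute h a from hh).zpow_right i).symm
    have hAC : A ≤ C := by
      rw [Subgroup.zpowers_le, hC]
    have hCn : C.Normal := inferInstance
    let N := C.map (QuotientGroup.mk' A)
    have hNn : N.Normal := Subgroup.Normal.map hCn _ (QuotientGroup.mk'_surjective A)
    have hNb : N ≠ ⊥ := by
      intro hb
      have : QuotientGroup.mk' A h0 ∈ N := Subgroup.mem_map_of_mem _ ((hC h0).2 hh0)
      rw [hb, Subgroup.mem_bot] at this
      exact hh0A ((QuotientGroup.eq_one_iff h0).1 this)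
    obtain ⟨c, hcN, hc1, hc⟩ := normal_center_aux p hp (hP.to_quotient A) N hNb
    obtain ⟨c, hcC, rfl⟩ := hcN
    have hcA : c ∉ A := fun hh => hc1 ((QuotientGroup.eq_one_iff c).2 hh)
    obtain ⟨m, hm1, hm2⟩ := pow_aux p hP A c hcA
    set h := c ^ p ^ m with hh
    have hhC : h * a = a * h := (hC h).1 (C.pow_mem hcC _)
    have hhc : ∀ x, x * h * x⁻¹ * h⁻¹ ∈ A := by
      intro x
      rw [← QuotientGroup.eq_one_iff]
      have h1 : Commute (QuotientGroup.mk' A x) (QuotientGroup.mk' A c) :=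
        mul_inv_eq_iff_eq_mul.1 (hc _)
      have h2 : Commute (QuotientGroup.mk' A x) (QuotientGroup.mk' A h) := by
        rw [hh, map_pow]; exact h1.pow_right _
      change QuotientGroup.mk' A (x * h * x⁻¹ * h⁻¹) = 1
      rw [map_mul, map_mul, map_mul, map_inv, map_inv, h2.eq]; group
    obtain ⟨t, ht⟩ := hm2
    simp only at ht
    have hpp : Prime (p : ℤ) := Nat.prime_iff_prime_int.1 hp
    by_cases hpt : (p : ℤ) ∣ t
    · obtain ⟨t', rfl⟩ := hpt
      have hpw : (h * a ^ (-t')) ^ p = 1 := by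
        rw [((show Commute h a from hhC).zpow_right (-t')).mul_pow, ← ht, ← zpow_natCast, ← zpow_mul,
          ← zpow_add]
        have : (p : ℤ) * t' + -t' * p = 0 := by ring
        rw [this, zpow_zero]
      exact hm1 ((Subgroup.mul_mem_cancel_right _ (Subgroup.zpow_mem_zpowers a _)).1 (hu a ha1 _ hpw))
    · obtain ⟨u, w, huw⟩ : IsCoprime ((p : ℤ) ^ n) t := ((Prime.coprime_iff_not_dvd hpp).2 hpt).pow_left
      have hah : a ∈ Subgroup.zpowers h := by
        have : a = (h ^ p) ^ w := by
          rw [← ht, ← zpow_mul]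
          have hone : a ^ ((p : ℤ) ^ n) = 1 := by
            rw [← orderOf_dvd_iff_zpow_eq_one, hn]; push_cast; rfl
          calc a = a ^ (u * (p : ℤ) ^ n + w * t) := by rw [huw, zpow_one]
            _ = _ := by rw [zpow_add, mul_comm u, zpow_mul, hone, one_zpow, one_mul, mul_comm]
        rw [this]
        exact Subgroup.zpow_mem _ (Subgroup.npow_mem_zpowers h p) w
      have hle : A ≤ Subgroup.zpowers h := by
        rw [Subgroup.zpowers_le]; exact hah
      have hhn : (Subgroup.zpowers h).Normal := by
        refine ⟨fun b hb g => ?_⟩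
        obtain ⟨i, rfl⟩ := hb
        simp only
        rw [← conj_zpow]
        apply Subgroup.zpow_mem
        have := hle (hhc g)
        exact (Subgroup.mul_mem_cancel_right _ (Subgroup.inv_mem _ (Subgroup.mem_zpowers h))).1 this
      have heq : A = Subgroup.zpowers h := by
        apply Subgroup.eq_of_le_of_card_ge hle
        rw [Nat.card_zpowers, Nat.card_zpowers]
        exact hmax' h hhn
      exact hm1 (heq ▸ Subgroup.mem_zpowers h)
  by_cases htop : ∀ x, x ∈ Subgroup.zpowers a
  · left
    exact ⟨a, htop⟩
  right
  push Not at htop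
  have hstep : ∀ y, y ∉ Subgroup.zpowers a → y ^ p ∈ Subgroup.zpowers a → _ := fun y hy hyp =>
    step_aux p n hp a y hn (hu a ha1) hy hyp (hconjA y)
      (fun hh => hy (hcent y (mul_inv_eq_iff_eq_mul.1 hh)))
  obtain ⟨x0, hx0⟩ := htop
  obtain ⟨m, hm1, hm2⟩ := pow_aux p hP _ x0 hx0
  generalize x0 ^ p ^ m = y at hm1 hm2
  obtain ⟨rfl, hya, t, ht, ht1, ht2⟩ := hstep y hm1 hm2
  have hn2 : 2 ≤ n := by
    by_contra hlt
    have hnc : a⁻¹ ≠ a := by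
      intro hh
      rw [hh] at hya
      exact hm1 (hcent y (mul_inv_eq_iff_eq_mul.1 hya))
    have : a ^ 2 = 1 := by
      rw [← orderOf_dvd_iff_pow_eq_one, hn]
      have := pow_dvd_pow 2 (show n ≤ 1 by omega)
      simpa using this
    exact hnc (inv_eq_of_mul_eq_one_right (by rw [← sq, this]))
  have hall : ∀ x, x ∈ Subgroup.zpowers a ∨ y⁻¹ * x ∈ Subgroup.zpowers a := by
    intro x
    by_cases hxA : x ∈ Subgroup.zpowers a
    · exact Or.inl hxA
    right
    obtain ⟨m, hx1, hx2⟩ := pow_aux 2 hP _ x hxA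
    have hinv := (hstep _ hx1 hx2).2.1
    rcases m with _ | m
    · rw [pow_zero, pow_one] at hinv
      apply hcent
      have h1 : x * a = a⁻¹ * x := mul_inv_eq_iff_eq_mul.1 hinv
      have h2 : y * a = a⁻¹ * y := mul_inv_eq_iff_eq_mul.1 hya
      have h3 : y⁻¹ * a⁻¹ = a * y⁻¹ := by
        rw [inv_mul_eq_iff_eq_mul, ← mul_assoc, h2]; group
      rw [mul_assoc, h1, ← mul_assoc, h3, mul_assoc]
    · exfalso
      rw [pow_succ, pow_mul] at hinv
      generalize x ^ 2 ^ m = v at hinv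
      obtain ⟨k, hk⟩ := hconjA v
      simp only at hk
      have h1 : v ^ 2 * a * (v ^ 2)⁻¹ = a ^ (k * k) := by
        have : v ^ 2 * a * (v ^ 2)⁻¹ = v * (v * a * v⁻¹) * v⁻¹ := by rw [sq]; group
        rw [this, ← hk, ← conj_zpow, ← hk, ← zpow_mul]
      rw [h1, eq_inv_iff_mul_eq_one, ← zpow_add_one, ← orderOf_dvd_iff_zpow_eq_one, hn] at hinv
      have h4 : (4 : ℤ) ∣ k * k + 1 := by
        refine dvd_trans ?_ hinv
        have := pow_dvd_pow (2 : ℤ) hn2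
        push_cast
        simpa using this
      rcases Int.even_or_odd' k with ⟨c, rfl | rfl⟩
      · ring_nf at h4; omega
      · ring_nf at h4; omega
  obtain ⟨k, rfl⟩ : ∃ k, n = k + 1 := ⟨n - 1, by omega⟩
  refine ⟨k, by omega, quat_aux k a y hn hm1 hya ?_ hall⟩
  rw [ht, ← zpow_natCast, zpow_eq_zpow_iff_modEq, hn]
  rw [pow_succ', mul_dvd_mul_iff_left (by norm_num)] at ht1
  obtain ⟨b, hb⟩ := ht1
  have hbo : Odd b := by
    by_contra h
    rw [Int.not_odd_iff_even] at h
    obtain ⟨e, he⟩ := h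
    exact ht2 ⟨e, by rw [hb, he]; ring⟩
  obtain ⟨e, he⟩ := hbo
  apply Int.ModEq.symm
  rw [Int.modEq_iff_dvd]
  exact ⟨e, by rw [hb, he]; push_cast; ring⟩

lemma fpf_comm {K V : Type*} [Group K] [Finite K] [CommGroup V] [MulDistribMulAction K V]
    (fpf : ∀ g : K, g ≠ 1 → ∀ v : V, g • v = v → v = 1)
    (v : V) (hv : ∀ r : ℕ, r.Prime → r ∣ Nat.card K → v ^ r ≠ 1) (r : ℕ) (hr : r.Prime)
    (a b : K) (hab : a * b = b * a) (ha : orderOf a = r) (hb : b ^ r = 1) :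
    b ∈ Subgroup.zpowers a := by
  by_contra hba
  have hc : Commute a b := hab
  refine hv r hr (ha ▸ orderOf_dvd_natCard a) ?_
  rw [← ha, ← Nat.card_zpowers a]
  refine fpf_key fpf (Subgroup.zpowers a) b r hr hba ?_ ?_ a (Subgroup.mem_zpowers a) ?_ v
  · rintro _ ⟨i, rfl⟩
    simp only
    rw [← (hc.zpow_left i).eq, mul_inv_cancel_right]
    exact Subgroup.zpow_mem_zpowers a i
  · rintro _ ⟨i, rfl⟩
    simp only
    rw [(hc.zpow_left i).mul_pow, hb, mul_one, ← zpow_natCast, ← zpow_mul, mul_comm, zpow_mul,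
      zpow_natCast, ← ha, pow_orderOf_eq_one, one_zpow]
  · rintro rfl
    rw [orderOf_one] at ha
    exact hr.one_lt.ne ha

lemma solvable_pgroup {K V : Type*} [Group K] [Finite K] [Nontrivial K] (hsolv : Group.IsSolvable K)
    (hK : IsEPPOGroup K) [CommGroup V] [MulDistribMulAction K V]
    (fpf : ∀ g : K, g ≠ 1 → ∀ v : V, g • v = v → v = 1)
    (v : V) (hv : ∀ r : ℕ, r.Prime → r ∣ Nat.card K → v ^ r ≠ 1) :
    ∃ r : ℕ, r.Prime ∧ IsPGroup r K := by
  classical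
  obtain ⟨M, hMn, hMb, hMc⟩ : ∃ M : Subgroup K, M.Normal ∧ M ≠ ⊥ ∧ ∀ a ∈ M, ∀ b ∈ M, a * b = b * a := by
    have hex := hsolv.solvable
    have h0 : Nat.find hex ≠ 0 := by
      intro h
      have := Nat.find_spec hex
      rw [h, derivedSeries_zero] at this
      exact top_ne_bot this
    refine ⟨derivedSeries K (Nat.find hex - 1), derivedSeries_normal K _, Nat.find_min hex (by omega), ?_⟩
    have h1 := Nat.find_spec hex
    obtain ⟨m, hm⟩ : ∃ m, Nat.find hex = m + 1 := ⟨Nat.find hex - 1, by omega⟩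
    rw [hm, derivedSeries_succ] at h1
    rw [hm, Nat.add_sub_cancel]
    intro a ha b hb
    have := Subgroup.commutator_mem_commutator ha hb
    rw [h1, Subgroup.mem_bot, commutatorElement_eq_one_iff_mul_comm] at this
    exact this
  obtain ⟨r, hr, hrM⟩ := Nat.exists_prime_and_dvd (n := Nat.card M)
    (fun h => hMb (Subgroup.card_eq_one.1 h))
  have := Fact.mk hr
  obtain ⟨⟨a, haM⟩, ha⟩ := exists_prime_orderOf_dvd_card' (G := M) r hrM
  rw [Subgroup.orderOf_mk] at ha
  have ha1 : a ≠ 1 := by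
    rintro rfl
    rw [orderOf_one] at ha
    exact hr.one_lt.ne ha
  have har : a ^ r = 1 := ha ▸ pow_orderOf_eq_one a
  have hconj : ∀ x, x * a * x⁻¹ ∈ Subgroup.zpowers a := by
    intro x
    have hm : x * a * x⁻¹ ∈ M := hMn.conj_mem a haM x
    refine fpf_comm fpf v hv r hr a _ (hMc _ haM _ hm) ha ?_
    rw [conj_pow, har]; simp
  have hNn : (Subgroup.zpowers a).Normal := by
    refine ⟨fun n hn g => ?_⟩
    obtain ⟨i, rfl⟩ := hn
    simp only
    rw [← conj_zpow]
    exact Subgroup.zpow_mem _ (hconj g) i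
  have hNr : ∀ n ∈ Subgroup.zpowers a, n ^ r = 1 := by
    rintro _ ⟨i, rfl⟩
    simp only
    rw [← zpow_natCast, ← zpow_mul, mul_comm, zpow_mul, zpow_natCast, har, one_zpow]
  refine ⟨r, hr, ?_⟩
  have hall : ∀ p : ℕ, p.Prime → p ∣ Nat.card K → p = r := by
    intro p hp hpK
    by_contra hpr
    have := Fact.mk hp
    obtain ⟨x, hx⟩ := exists_prime_orderOf_dvd_card' (G := K) p hpK
    have hcop : Nat.Coprime p r := (Nat.coprime_primes hp hr).2 hpr
    have hxp : x ^ p = 1 := hx ▸ pow_orderOf_eq_one x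
    have hx1 : x ≠ 1 := by
      rintro rfl
      rw [orderOf_one] at hx
      exact hp.one_lt.ne hx
    have hcop1 : ∀ g : K, g ^ p = 1 → g ^ r = 1 → g = 1 := by
      intro g h1 h2
      have h3 : orderOf g ∣ Nat.gcd p r :=
        Nat.dvd_gcd (orderOf_dvd_of_pow_eq_one h1) (orderOf_dvd_of_pow_eq_one h2)
      rw [hcop.gcd_eq_one] at h3
      exact orderOf_eq_one_iff.1 (Nat.dvd_one.1 h3)
    have hxN : x ∉ Subgroup.zpowers a := fun h => hx1 (hcop1 x hxp (hNr x h))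
    refine hv r hr (ha ▸ orderOf_dvd_natCard a) ?_
    rw [← ha, ← Nat.card_zpowers a]
    refine fpf_key fpf (Subgroup.zpowers a) x p hp hxN (fun n hn => hNn.conj_mem n hn x) ?_ a
      (Subgroup.mem_zpowers a) ha1 v
    intro n hn
    have hq : ∀ m : ℕ, QuotientGroup.mk' (Subgroup.zpowers a) ((n * x) ^ m)
        = QuotientGroup.mk' (Subgroup.zpowers a) (x ^ m) := by
      intro m
      rw [map_pow, map_mul, map_pow]
      have : QuotientGroup.mk' (Subgroup.zpowers a) n = 1 := (QuotientGroup.eq_one_iff n).2 hn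
      rw [this, one_mul]
    have hmem : ∀ m : ℕ, (n * x) ^ m ∈ Subgroup.zpowers a ↔ x ^ m ∈ Subgroup.zpowers a := by
      intro m
      rw [← QuotientGroup.eq_one_iff, ← QuotientGroup.eq_one_iff]
      exact Eq.congr_left (hq m)
    have h1 : (n * x) ^ p ∈ Subgroup.zpowers a := (hmem p).2 (hxp ▸ Subgroup.one_mem _)
    have h2 : (n * x) ^ (p * r) = 1 := by rw [pow_mul]; exact hNr _ h1
    obtain ⟨s, m, hs, hsm⟩ := hK (n * x)
    have h3 : s ^ m ∣ p * r := hsm ▸ orderOf_dvd_of_pow_eq_one h2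
    rw [← orderOf_dvd_iff_pow_eq_one, hsm]
    by_cases hsr : s = r
    · exfalso
      subst hsr
      have h4 : s ^ m ∣ s := (Nat.Coprime.pow_left m hcop.symm).dvd_of_dvd_mul_left h3
      have h5 : (n * x) ^ s = 1 := by rw [← orderOf_dvd_iff_pow_eq_one, hsm]; exact h4
      have h6 : x ^ s ∈ Subgroup.zpowers a := (hmem s).1 (h5 ▸ Subgroup.one_mem _)
      have h7 : x ^ s = 1 := hcop1 _ (by rw [← pow_mul, mul_comm, pow_mul, hxp, one_pow]) (hNr _ h6)
      exact hx1 (hcop1 x hxp h7)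
    · exact (Nat.Coprime.pow_left m ((Nat.coprime_primes hs hr).2 hsr)).dvd_of_dvd_mul_right h3
  refine IsPGroup.of_card (n := (Nat.card K).primeFactorsList.length) ?_
  exact Nat.eq_prime_pow_of_unique_prime_dvd Nat.card_pos.ne' (fun {d} hd hdd => hall d hd hdd)

theorem solvable_coprime_subgroup_cyclic_or_quaternion {G : Type*} [Group G] [Finite G]
    (hG : IsEPPOGroup G) {q : ℕ} (hq : q.Prime) (Q : Subgroup G) [Q.Normal]
    (hQ : Q ≠ ⊥) (hQq : IsPGroup q Q)
    (H : Subgroup G) (hsolv : IsSolvable H) (hco : Nat.Coprime (Nat.card H) q) :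
    (∃ p : ℕ, p.Prime ∧ IsPGroup p H ∧ IsCyclic H) ∨
      (∃ k : ℕ, 1 ≤ k ∧ Nonempty (H ≃* QuaternionGroup (2 ^ k))) := by
  rcases subsingleton_or_nontrivial H with hs | hnt
  · left
    exact ⟨2, Nat.prime_two, fun g => ⟨0, Subsingleton.elim _ _⟩, inferInstance⟩
  have := Fact.mk hq
  let A : Subgroup G := (Subgroup.center Q).map Q.subtype
  have hAn : A.Normal := inferInstance
  have hAQ : A ≤ Q := Subgroup.map_subtype_le _
  have hAc : ∀ a ∈ A, ∀ b ∈ A, a * b = b * a := by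
    rintro _ ⟨a, ha, rfl⟩ _ ⟨b, hb, rfl⟩
    exact congrArg Subtype.val ((Subgroup.mem_center_iff.1 hb) a)
  have hQnt : Nontrivial Q := (Subgroup.nontrivial_iff_ne_bot Q).2 hQ
  have := hQq.center_nontrivial
  obtain ⟨c, hc⟩ := exists_ne (1 : Subgroup.center Q)
  let v : A := ⟨((c : Q) : G), ⟨c, c.2, rfl⟩⟩
  have hv1 : v ≠ 1 := by
    intro h
    apply hc
    apply Subtype.ext
    apply Subtype.ext
    exact congrArg (fun w : A => (w : G)) h
  let cg : CommGroup A := { (inferInstance : Group A) with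
    mul_comm := fun a b => Subtype.ext (hAc a a.2 b b.2) }
  let act : MulDistribMulAction H A :=
    MulDistribMulAction.compHom A ((MulAut.conjNormal (H := A)).comp H.subtype)
  have hsm : ∀ (x : H) (c : A), ((x • c : A) : G) = x * c * (x : G)⁻¹ := fun x c =>
    MulAut.conjNormal_apply (x : G) c
  have hpow : ∀ w : A, ∃ k : ℕ, orderOf (w : G) = q ^ k := by
    intro w
    obtain ⟨k, hk⟩ := IsPGroup.iff_orderOf.1 hQq ⟨w, hAQ w.2⟩
    rw [Subgroup.orderOf_mk] at hk
    exact ⟨k, hk⟩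
  have hKE : IsEPPOGroup H := by
    intro g
    obtain ⟨p, n, hp, h⟩ := hG g
    exact ⟨p, n, hp, by rw [← h, Subgroup.orderOf_coe]⟩
  have fpf : ∀ g : H, g ≠ 1 → ∀ v : A, g • v = v → v = 1 := by
    intro g hg w hw
    by_contra hw1
    have hcomm : Commute (g : G) (w : G) := by
      have := hsm g w
      rw [hw] at this
      exact mul_inv_eq_iff_eq_mul.1 this.symm
    obtain ⟨k, hk⟩ := hpow w
    have hgd : orderOf (g : G) ∣ Nat.card H := by
      rw [Subgroup.orderOf_coe]; exact orderOf_dvd_natCard g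
    have hcop : Nat.Coprime (orderOf (g : G)) (orderOf (w : G)) := by
      rw [hk]
      exact (Nat.Coprime.coprime_dvd_left hgd hco).pow_right k
    have hgw := hcomm.orderOf_mul_eq_mul_orderOf_of_coprime hcop
    obtain ⟨s, m, hs, hsm'⟩ := hG ((g : G) * w)
    rw [hsm'] at hgw
    have hg1 : orderOf (g : G) ≠ 1 := by
      rw [Ne, orderOf_eq_one_iff]; simpa using hg
    have hw1' : orderOf (w : G) ≠ 1 := by
      rw [Ne, orderOf_eq_one_iff]; simpa using hw1
    have d1 : s ∣ orderOf (g : G) := by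
      obtain ⟨i, -, hi⟩ := (Nat.dvd_prime_pow hs).1 (Dvd.intro _ hgw.symm)
      rw [hi] at hg1 ⊢
      exact dvd_pow_self s (by rintro rfl; simp at hg1)
    have d2 : s ∣ orderOf (w : G) := by
      obtain ⟨i, -, hi⟩ := (Nat.dvd_prime_pow hs).1 (Dvd.intro_left _ hgw.symm)
      rw [hi] at hw1' ⊢
      exact dvd_pow_self s (by rintro rfl; simp at hw1')
    have := Nat.dvd_gcd d1 d2
    rw [hcop.gcd_eq_one] at this
    exact hs.one_lt.ne' (Nat.dvd_one.1 this)
  have hv : ∀ r : ℕ, r.Prime → r ∣ Nat.card H → v ^ r ≠ 1 := by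
    intro r hr hrd h
    obtain ⟨k, hk⟩ := hpow v
    have h1 : orderOf (v : G) ∣ r := by
      apply orderOf_dvd_of_pow_eq_one
      exact congrArg Subtype.val h
    have h2 : Nat.Coprime r (orderOf (v : G)) := by
      rw [hk]; exact (Nat.Coprime.coprime_dvd_left hrd hco).pow_right k
    have h3 := Nat.eq_one_of_dvd_coprimes h2 h1 dvd_rfl
    rw [orderOf_eq_one_iff] at h3
    exact hv1 (Subtype.ext h3)
  obtain ⟨r, hr, hrH⟩ := solvable_pgroup hsolv hKE fpf v hv
  rcases classify_aux r hr hrH (fun a b hab ha hb => fpf_comm fpf v hv r hr a b hab ha hb) with h | h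
  · exact Or.inl ⟨r, hr, hrH, h⟩
  · exact Or.inr h
end

section
/- Let G be a finite solvable EPPO-group with a nontrivial normal q-subgroup for a prime q. Then |G| = p^α q^β for some prime p and nonnegative integers α, β. -/
theorem core_aux {A G : Type*} [CommGroup A] [Group G] [Finite G] (φ : G →* MulAut A)
    (P C : Subgroup G) (hn : ∀ d ∈ C, ∀ x ∈ P, d * x * d⁻¹ ∈ P)
    (hPC : ∀ d ∈ C, d ≠ 1 → ∀ x ∈ P, Commute x d → x = 1)
    (hP : ∀ v, (∀ x ∈ P, φ x v = v) → v = 1)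
    (hC : ∀ v, (∀ x ∈ C, φ x v = v) → v = 1) (v : A) : v ^ Nat.card P = 1 := by
  classical
  have := Fintype.ofFinite G
  have norm : ∀ H : Subgroup G, (∀ v, (∀ x ∈ H, φ x v = v) → v = 1) →
      ∀ v, ∏ x : H, φ x v = 1 := by
    intro H hH v
    apply hH
    intro y hy
    rw [map_prod]
    refine Fintype.prod_equiv (Equiv.mulLeft (⟨y, hy⟩ : H)) _ _ ?_
    intro x
    simp
  have h1 : ∏ x : P, ∏ d : C, φ ((x : G) * d * (x : G)⁻¹) v = 1 := by
    apply Finset.prod_eq_one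
    intro x _
    have := congrArg (φ (x : G)) (norm C hC (φ (x : G)⁻¹ v))
    rw [map_prod, map_one] at this
    rw [← this]
    apply Finset.prod_congr rfl
    intro d _
    simp only [map_mul, MulAut.mul_apply]
  rw [Finset.prod_comm, Finset.prod_eq_single (1 : C)] at h1
  · simpa using h1
  · intro d _ hd
    have hd' : (d : G) ≠ 1 := by simpa using hd
    let f : P → P := fun x => x * ⟨(d : G) * (x : G)⁻¹ * (d : G)⁻¹, hn d d.2 _ (P.inv_mem x.2)⟩
    have hf : Function.Injective f := by
      intro x y hxy
      have e : (x : G) * (d * (x : G)⁻¹ * (d : G)⁻¹) = y * (d * (y : G)⁻¹ * (d : G)⁻¹) :=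
        congrArg Subtype.val hxy
      have e2 : (x : G) * d * (x : G)⁻¹ = y * d * (y : G)⁻¹ := by
        have := congrArg (· * (d : G)) e
        simpa [mul_assoc] using this
      have := hPC d d.2 hd' ((y : G)⁻¹ * x) (P.mul_mem (P.inv_mem y.2) x.2) (by
        have e3 := congrArg (fun t => (y : G)⁻¹ * t * x) e2
        simp [mul_assoc] at e3
        simp [Commute, SemiconjBy, mul_assoc, e3])
      exact Subtype.ext (inv_mul_eq_one.mp this).symm
    rw [← norm P hP (φ d v)]
    refine Fintype.prod_bijective f (Finite.injective_iff_bijective.mp hf) _ _ ?_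
    intro x
    simp only [f, Subgroup.coe_mul, ← MulAut.mul_apply, ← map_mul]
    simp [mul_assoc]
  · simp

theorem comm_aux {G : Type*} [Group G] (hG : ∀ g : G, ∃ (p n : ℕ), p.Prime ∧ orderOf g = p ^ n)
    {p q i j : ℕ} (hp : p.Prime) (hq : q.Prime) (hpq : p ≠ q) {a b : G}
    (ha : orderOf a = p ^ i) (hb : orderOf b = q ^ j) (hab : Commute a b) : a = 1 ∨ b = 1 := by
  have hco : (orderOf a).Coprime (orderOf b) := by
    rw [ha, hb]; exact Nat.Coprime.pow _ _ ((Nat.coprime_primes hp hq).mpr hpq)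
  have ho := hab.orderOf_mul_eq_mul_orderOf_of_coprime hco
  obtain ⟨l, n, hl, h⟩ := hG (a * b)
  rw [← orderOf_eq_one_iff, ← orderOf_eq_one_iff (x := b)]
  by_contra! hne
  rw [h] at ho
  have key : ∀ m, m ∣ l ^ n → m ≠ 1 → l ∣ m := by
    intro m hm hm1
    obtain ⟨k, _, rfl⟩ := (Nat.dvd_prime_pow hl).mp hm
    exact dvd_pow_self _ (by rintro rfl; simp at hm1)
  exact hl.one_lt.ne' (Nat.dvd_one.mp (hco ▸ Nat.dvd_gcd (key _ (ho ▸ dvd_mul_right _ _) hne.1)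
    (key _ (ho ▸ dvd_mul_left _ _) hne.2)))

theorem exists_normal_p {G : Type*} [Group G] [Finite G] [Group.IsSolvable G] [Nontrivial G] :
    ∃ (s : ℕ) (T : Subgroup G), s.Prime ∧ T.Normal ∧ T ≠ ⊥ ∧ IsPGroup s T := by
  classical
  have hs : ∃ n, derivedSeries G n = ⊥ := Group.IsSolvable.solvable
  obtain ⟨n, hn, hn'⟩ : ∃ n, derivedSeries G n ≠ ⊥ ∧ derivedSeries G (n + 1) = ⊥ := by
    have h0 : Nat.find hs ≠ 0 := by
      intro h
      have := Nat.find_spec hs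
      rw [h, derivedSeries_zero] at this
      exact top_ne_bot this
    obtain ⟨m, hm⟩ := Nat.exists_eq_succ_of_ne_zero h0
    exact ⟨m, Nat.find_min hs (by omega), by
      have := Nat.find_spec hs
      rwa [hm] at this⟩
  set D := derivedSeries G n with hD
  have hcomm : ∀ x ∈ D, ∀ y ∈ D, x * y = y * x := by
    rw [derivedSeries_succ, Subgroup.commutator_eq_bot_iff_le_centralizer] at hn'
    intro x hx y hy
    exact (Subgroup.mem_centralizer_iff.mp (hn' hx) y hy).symm
  have hDn : D.Normal := derivedSeries_normal G n
  have hc1 : Nat.card D ≠ 1 := by rwa [Ne, Subgroup.card_eq_one]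
  obtain ⟨s, hsp, hsd⟩ := Nat.exists_prime_and_dvd hc1
  have : Fact s.Prime := ⟨hsp⟩
  let S : Sylow s D := default
  have hSn : (S : Subgroup D).Normal := ⟨fun x hx g => by
    have : g * x * g⁻¹ = x := by
      apply Subtype.ext
      simp [hcomm g g.2 x x.2]
    rwa [this]⟩
  have := S.characteristic_of_normal hSn
  refine ⟨s, (S : Subgroup D).map D.subtype, hsp, inferInstance, ?_, S.2.map _⟩
  rw [Ne, Subgroup.map_eq_bot_iff_of_injective _ D.subtype_injective]
  exact S.ne_bot_of_dvd_card hsd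

theorem num_aux {n s q : ℕ} (hn : n ≠ 0) (hq : q.Prime)
    (h : ∀ r, r.Prime → r ∣ n → r = s ∨ r = q) : ∃ α β, n = s ^ α * q ^ β := by
  obtain ⟨β, m, hm, rfl⟩ := Nat.exists_eq_pow_mul_and_not_dvd hn q hq.ne_one
  have hm0 : m ≠ 0 := by rintro rfl; simp at hm
  refine ⟨m.primeFactorsList.length, β, ?_⟩
  rw [mul_comm]
  congr 1
  refine Nat.eq_prime_pow_of_unique_prime_dvd hm0 ?_
  intro d hd hdm
  rcases h d hd (hdm.mul_left _) with h | rfl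
  · exact h
  · exact absurd hdm hm

theorem solvable_EPPO_with_normal_qSubgroup_order {G : Type*} [Group G] [Finite G]
    (hG : IsEPPOGroup G) (hsolv : IsSolvable G) {q : ℕ} (hq : q.Prime)
    (Q : Subgroup G) [Q.Normal] (hQ : Q ≠ ⊥) (hQq : IsPGroup q Q) :
    ∃ (p : ℕ) (α β : ℕ), p.Prime ∧ Nat.card G = p ^ α * q ^ β := by
  classical
  have : Fact q.Prime := ⟨hq⟩
  haveI : Group.IsSolvable G := hsolv
  obtain ⟨N, hQN, hN⟩ := Finite.exists_le_maximal (p := fun N : Subgroup G => N.Normal ∧ IsPGroup q N)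
    (a := Q) ⟨inferInstance, hQq⟩
  have hNn : N.Normal := hN.prop.1
  have hNq : IsPGroup q N := hN.prop.2
  have hN0 : N ≠ ⊥ := fun h => hQ (le_bot_iff.mp (h ▸ hQN))
  obtain ⟨b, hb⟩ := IsPGroup.iff_card.mp hNq
  by_cases htop : N = ⊤
  · refine ⟨2, 0, b, Nat.prime_two, ?_⟩
    rw [pow_zero, one_mul, ← hb, htop, Subgroup.card_top]
  have : Nontrivial (G ⧸ N) := by
    rwa [QuotientGroup.nontrivial_iff]
  obtain ⟨s, T, hs, hTn, hT0, hTs⟩ := exists_normal_p (G := G ⧸ N)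
  have : Fact s.Prime := ⟨hs⟩
  obtain ⟨a, ha⟩ := IsPGroup.iff_card.mp hTs
  have ha0 : a ≠ 0 := by
    rintro rfl
    rw [pow_zero, Subgroup.card_eq_one] at ha
    exact hT0 ha
  set M := T.comap (QuotientGroup.mk' N) with hM
  have hMn : M.Normal := hTn.comap _
  have hNM : N ≤ M := by
    intro x hx
    rw [hM, Subgroup.mem_comap, QuotientGroup.mk'_apply, (QuotientGroup.eq_one_iff x).mpr hx]
    exact T.one_mem
  have hMc : Nat.card M = s ^ a * q ^ b := by
    rw [← ha, ← hb]
    have h1 := M.card_mul_index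
    have h2 := T.card_mul_index
    have h3 := N.card_mul_index
    have h4 : M.index = T.index := Subgroup.index_comap_of_surjective _ (QuotientGroup.mk'_surjective N)
    rw [Subgroup.index_eq_card N, ← h2, ← h1, ← h4] at h3
    have : M.index ≠ 0 := Subgroup.index_ne_zero_of_finite
    apply mul_right_cancel₀ this
    rw [← h3]; ring
  have hsq : s ≠ q := by
    rintro rfl
    have hMq : IsPGroup s M := IsPGroup.of_card (n := a + b) (by rw [hMc, pow_add])
    have hMN : M ≤ N := hN.le_of_ge ⟨hMn, hMq⟩ hNM
    have : N = M := le_antisymm hNM hMN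
    rw [← this, hb] at hMc
    rw [← pow_add] at hMc
    have := Nat.pow_right_injective hs.two_le hMc
    omega
  have hfin : Nat.card G ≠ 0 := Nat.card_pos.ne'
  suffices h : ∀ r, r.Prime → r ∣ Nat.card G → r = s ∨ r = q by
    obtain ⟨α, β, h⟩ := num_aux hfin hq h
    exact ⟨s, α, β, hs, h⟩
  intro r hr hrG
  by_contra! hne
  obtain ⟨hrs, hrq⟩ := hne
  have : Fact r.Prime := ⟨hr⟩
  let P0 : Sylow s M := default
  set P : Subgroup G := (P0 : Subgroup M).map M.subtype with hPdef
  have hPs : IsPGroup s P := P0.2.map _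
  have hP0 : P ≠ ⊥ := by
    rw [hPdef, Ne, Subgroup.map_eq_bot_iff_of_injective _ M.subtype_injective]
    exact P0.ne_bot_of_dvd_card (hMc ▸ (dvd_pow_self s ha0).mul_right _)
  have hfr := Sylow.normalizer_sup_eq_top P0
  rw [← hPdef] at hfr
  have hrK : r ∣ Nat.card (Subgroup.normalizer (P : Set G)) := by
    have hd : Nat.card G ∣ Nat.card M * Nat.card (Subgroup.normalizer (P : Set G)) := by
      rw [← M.card_mul_index, ← Subgroup.relIndex_top_right, ← hfr, Subgroup.relIndex_sup_right]
      exact mul_dvd_mul_left _ (Subgroup.relIndex_dvd_card _ _)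
    rcases (hr.dvd_mul).mp (hrG.trans hd) with h | h
    · rw [hMc] at h
      rcases hr.dvd_mul.mp h with h | h
      · exact absurd ((Nat.prime_dvd_prime_iff_eq hr hs).mp (hr.dvd_of_dvd_pow h)) hrs
      · exact absurd ((Nat.prime_dvd_prime_iff_eq hr hq).mp (hr.dvd_of_dvd_pow h)) hrq
    · exact h
  obtain ⟨c, hc⟩ := exists_prime_orderOf_dvd_card' r hrK
  have hcG : orderOf (c : G) = r := by rw [Subgroup.orderOf_coe]; exact hc
  let C : Subgroup G := Subgroup.zpowers (c : G)
  have hCr : IsPGroup r C := IsPGroup.of_card (n := 1) (by rw [Nat.card_zpowers, hcG, pow_one])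
  have hC0 : C ≠ ⊥ := by
    rw [Ne, Subgroup.zpowers_eq_bot]
    intro h; rw [h, orderOf_one] at hcG; exact hr.one_lt.ne hcG
  have hCK : C ≤ Subgroup.normalizer (P : Set G) := by
    rw [Subgroup.zpowers_le]; exact c.2
  have ord : ∀ {p : ℕ} [Fact p.Prime] {H : Subgroup G}, IsPGroup p H → ∀ x ∈ H,
      ∃ k, orderOf x = p ^ k := by
    intro p _ H hH x hx
    obtain ⟨k, hk⟩ := IsPGroup.iff_orderOf.mp hH ⟨x, hx⟩
    exact ⟨k, by rw [← hk, Subgroup.orderOf_mk]⟩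
  have cm : ∀ {p p' : ℕ} [Fact p.Prime] [Fact p'.Prime], p ≠ p' → ∀ {H H' : Subgroup G},
      IsPGroup p H → IsPGroup p' H' → ∀ x ∈ H, ∀ y ∈ H', Commute x y → x = 1 ∨ y = 1 := by
    intro p p' hp hp' hpp H H' hH hH' x hx y hy hxy
    obtain ⟨i, hi⟩ := ord hH x hx
    obtain ⟨j, hj⟩ := ord hH' y hy
    exact comm_aux hG hp.out hp'.out hpp hi hj hxy
  let V : Subgroup G := (Subgroup.center N).map N.subtype
  have hVn : V.Normal := inferInstance
  have hVN : V ≤ N := Subgroup.map_subtype_le _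
  have hVq : IsPGroup q V := hNq.to_le hVN
  have hV0 : V ≠ ⊥ := by
    have : Nontrivial N := (Subgroup.nontrivial_iff_ne_bot N).mpr hN0
    have := hNq.center_nontrivial
    rw [Ne, Subgroup.map_eq_bot_iff_of_injective _ N.subtype_injective]
    exact (Subgroup.nontrivial_iff_ne_bot _).mp this
  have hVc : ∀ x y : V, x * y = y * x := by
    rintro ⟨_, x, hx, rfl⟩ ⟨_, y, hy, rfl⟩
    apply Subtype.ext
    have h : x * y = y * x := Subgroup.mem_center_iff.mp hy x
    exact congrArg (fun t : N => (t : G)) h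
  letI : CommGroup V := { (inferInstance : Group V) with mul_comm := hVc }
  have fix : ∀ {p : ℕ} [Fact p.Prime] {H : Subgroup G}, p ≠ q → IsPGroup p H → H ≠ ⊥ →
      ∀ v : V, (∀ x ∈ H, (MulAut.conjNormal x : MulAut V) v = v) → v = 1 := by
    intro p _ H hpq hH hH0 v hv
    obtain ⟨⟨x, hx⟩, hx0⟩ := Subgroup.ne_bot_iff_exists_ne_one.mp hH0
    have hx1 : x ≠ 1 := fun h => hx0 (Subtype.ext h)
    have h := congrArg Subtype.val (hv x hx)
    rw [MulAut.conjNormal_apply] at h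
    have hcm : Commute x (v : G) := mul_inv_eq_iff_eq_mul.mp h
    rcases cm hpq hH hVq x hx v v.2 hcm with h | h
    · exact absurd h hx1
    · exact Subtype.ext h
  obtain ⟨k, hk⟩ := IsPGroup.iff_card.mp hPs
  obtain ⟨v, hv⟩ := Subgroup.ne_bot_iff_exists_ne_one.mp hV0
  have hvP := core_aux (MulAut.conjNormal : G →* MulAut V) P C
    (fun d hd x hx => (Subgroup.mem_normalizer_iff.mp (hCK hd) x).mp hx)
    (fun d hd hd1 x hx hxd => (cm hrs.symm hPs hCr x hx d hd hxd).resolve_right hd1)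
    (fix hsq hPs hP0) (fix hrq hCr hC0) v
  obtain ⟨j, hj⟩ := IsPGroup.iff_orderOf.mp hVq v
  have hdv : orderOf v ∣ s ^ k := hk ▸ orderOf_dvd_of_pow_eq_one hvP
  apply hv
  rw [← orderOf_eq_one_iff]
  refine Nat.Coprime.eq_one_of_dvd ?_ hdv
  rw [hj]
  exact Nat.Coprime.pow _ _ ((Nat.coprime_primes hq hs).mpr hsq.symm)
end
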